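/- Coercivity via oscillation (finite-dimensional core): suppose $J \in \mathbb{R}^{D\times m}$-valued field on $X$ decomposes as $J = (Jw^T)a + (Ju^T)b$, and suppose $\|J - cb\|_{L^2}^2 \le C_1 \mathfrak{a}(J,J)$ where $c = \langle Ju^T\rangle$, and that for every divergence-free $J$ and every test function $\varphi \in C_c^\infty(X)$, $|\langle \varphi, c\cdot\nabla b_j\rangle| \le C_2 \|\varphi\| \, \mathfrak{a}(J,J)^{1/2}$ for all $j$. If the oscillation constant $\mathfrak{O} = \min_{|\theta|=1}\max_j \langle (\theta\cdot\nabla b_j)^2\rangle$ is positive, then $|c|^2 \, \mathfrak{O} \le C \, \mathfrak{a}(J,J)$, and hence $\|J\|_{L^2}^2 \le \frac{C'}{\mathfrak{O}}\mathfrak{a}(J,J)$. -/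

import Mathlib

open MeasureTheory

theorem stmt14_aux {D : ℕ} {X : Set (Fin D → ℝ)}
    (hXopen : IsOpen X) (hXbdd : Bornology.IsBounded X)
    (g : (Fin D → ℝ) → ℝ) (hg : Continuous g) (a C : ℝ) (ha : 0 ≤ a) (hC : 0 ≤ C)
    (ht : ∀ φ : (Fin D → ℝ) → ℝ, ContDiff ℝ (⊤ : ℕ∞) φ → HasCompactSupport φ →
      tsupport φ ⊆ X → |∫ x in X, φ x * g x| ≤
        C * (∫ x in X, (φ x) ^ 2) ^ (1 / 2 : ℝ) * a ^ (1 / 2 : ℝ)) :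
    ∫ x in X, (g x) ^ 2 ≤ C ^ 2 * a := by
  obtain ⟨f, fs, fd, fr⟩ := hXopen.exists_contDiff_support_eq (n := ⊤)
  have hψ : ∀ n : ℕ, ∃ ψ : (Fin D → ℝ) → ℝ, ContDiff ℝ (⊤ : ℕ∞) ψ ∧
      ∀ x, dist (ψ x) (g x) < 1 / ((n : ℝ) + 1) := by
    intro n
    obtain ⟨ψ, h1, h2, -⟩ := hg.exists_contDiff_approx ⊤ (ε := fun _ => 1 / ((n : ℝ) + 1))
      (by fun_prop) (fun x => by positivity)
    exact ⟨ψ, h1, h2⟩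
  choose ψ hψd hψ using hψ
  let χ : ℕ → (Fin D → ℝ) → ℝ := fun n x => Real.smoothTransition ((n : ℝ) * f x - 1)
  let φ : ℕ → (Fin D → ℝ) → ℝ := fun n x => χ n x * ψ n x
  have hχd : ∀ n, ContDiff ℝ (⊤ : ℕ∞) (χ n) := fun n =>
    Real.smoothTransition.contDiff.comp ((contDiff_const.mul fd).sub contDiff_const)
  have hφd : ∀ n, ContDiff ℝ (⊤ : ℕ∞) (φ n) := fun n => (hχd n).mul (hψd n)
  have hsub : ∀ n, tsupport (φ n) ⊆ {x | 1 ≤ (n : ℝ) * f x} := by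
    intro n
    refine closure_minimal ?_ (isClosed_le continuous_const (continuous_const.mul fd.continuous))
    intro x hx
    by_contra hc
    apply hx
    have : χ n x = 0 := Real.smoothTransition.zero_of_nonpos (by
      simp only [Set.mem_setOf_eq, not_le] at hc; linarith)
    simp [φ, this]
  have hsubX : ∀ n, tsupport (φ n) ⊆ X := by
    intro n x hx
    have := hsub n hx
    rw [← fs]
    intro h0
    simp only [Set.mem_setOf_eq, h0] at this
    norm_num at this
  have hcs : ∀ n, HasCompactSupport (φ n) := fun n =>
    Metric.isCompact_of_isClosed_isBounded (isClosed_tsupport _) (hXbdd.subset (hsubX n))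
  have hfin : volume X < ⊤ := hXbdd.measure_lt_top
  haveI : IsFiniteMeasure (volume.restrict X) := ⟨by simpa using hfin⟩
  obtain ⟨M, hM⟩ := hXbdd.isCompact_closure.exists_bound_of_continuousOn hg.continuousOn
  have hMX : ∀ x ∈ X, |g x| ≤ M := fun x hx => hM x (subset_closure hx)
  have hψb : ∀ n, ∀ x ∈ X, |φ n x| ≤ |M| + 1 := by
    intro n x hx
    have h1 := hψ n x
    have h2 : 1 / ((n : ℝ) + 1) ≤ 1 := by
      rw [div_le_one (by positivity)]; linarith [(Nat.cast_nonneg n : (0:ℝ) ≤ n)]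
    rw [Real.dist_eq] at h1
    have h3 : |ψ n x| ≤ |M| + 1 := by
      have := abs_sub_abs_le_abs_sub (ψ n x) (g x)
      have := hMX x hx
      have := le_abs_self M
      linarith
    have h4 : |χ n x| ≤ 1 := by
      rw [abs_of_nonneg (Real.smoothTransition.nonneg _)]
      exact Real.smoothTransition.le_one _
    calc |φ n x| = |χ n x| * |ψ n x| := abs_mul _ _
      _ ≤ 1 * (|M| + 1) := mul_le_mul h4 h3 (abs_nonneg _) zero_le_one
      _ = _ := one_mul _
  have hlim : ∀ x ∈ X, Filter.Tendsto (fun n => φ n x) Filter.atTop (nhds (g x)) := by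
    intro x hx
    have hf0 : f x ≠ 0 := by rw [← fs] at hx; exact hx
    have hf : 0 < f x := lt_of_le_of_ne (fr ⟨x, rfl⟩).1 hf0.symm
    have h1 : Filter.Tendsto (fun n => ψ n x) Filter.atTop (nhds (g x)) := by
      rw [tendsto_iff_dist_tendsto_zero]
      exact squeeze_zero (fun _ => dist_nonneg) (fun n => (hψ n x).le)
        tendsto_one_div_add_atTop_nhds_zero_nat
    refine h1.congr' ?_
    obtain ⟨N, hN⟩ := exists_nat_ge (2 / f x)
    filter_upwards [Filter.eventually_ge_atTop N] with n hn
    have : χ n x = 1 := Real.smoothTransition.one_of_one_le (by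
      have h5 : 2 / f x ≤ n := hN.trans (by exact_mod_cast hn)
      rw [div_le_iff₀ hf] at h5
      linarith)
    simp [φ, this]
  have hmX := hXopen.measurableSet
  have L1 : Filter.Tendsto (fun n => ∫ x in X, φ n x * g x) Filter.atTop
      (nhds (∫ x in X, (g x) ^ 2)) := by
    refine tendsto_integral_of_dominated_convergence (fun _ => (|M| + 1) * |M|)
      (fun n => ((hφd n).continuous.mul hg).aestronglyMeasurable) (integrable_const _) ?_ ?_
    · intro n
      filter_upwards [ae_restrict_mem hmX] with x hx
      rw [Real.norm_eq_abs, abs_mul]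
      exact mul_le_mul (hψb n x hx) ((hMX x hx).trans (le_abs_self M)) (abs_nonneg _)
        (by positivity)
    · filter_upwards [ae_restrict_mem hmX] with x hx
      rw [pow_two]
      exact (hlim x hx).mul_const _
  have L2 : Filter.Tendsto (fun n => ∫ x in X, (φ n x) ^ 2) Filter.atTop
      (nhds (∫ x in X, (g x) ^ 2)) := by
    refine tendsto_integral_of_dominated_convergence (fun _ => (|M| + 1) ^ 2)
      (fun n => ((hφd n).continuous.pow 2).aestronglyMeasurable) (integrable_const _) ?_ ?_
    · intro n
      filter_upwards [ae_restrict_mem hmX] with x hx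
      rw [Real.norm_eq_abs, abs_pow]
      exact pow_le_pow_left₀ (abs_nonneg _) (hψb n x hx) 2
    · filter_upwards [ae_restrict_mem hmX] with x hx
      exact (hlim x hx).pow 2
  have hA : 0 ≤ ∫ x in X, (g x) ^ 2 := integral_nonneg fun x => sq_nonneg _
  have key := le_of_tendsto_of_tendsto' L1.abs
    (((L2.rpow_const (p := (1 / 2 : ℝ)) (Or.inr (by norm_num))).const_mul C).mul_const
      (a ^ (1 / 2 : ℝ)))
    (fun n => ht (φ n) (hφd n) (hcs n) (hsubX n))
  generalize (∫ x in X, (g x) ^ 2) = A at *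
  rw [abs_of_nonneg hA, ← Real.sqrt_eq_rpow, ← Real.sqrt_eq_rpow] at key
  have hs := Real.sq_sqrt hA
  have hsa := Real.sq_sqrt ha
  have p1 := Real.sqrt_nonneg A
  have p2 := Real.sqrt_nonneg a
  rcases p1.eq_or_lt with h0 | h0
  · rw [← h0] at hs
    have : 0 ≤ C ^ 2 * a := by positivity
    linarith
  · have h6 : Real.sqrt A ≤ C * Real.sqrt a := by
      refine le_of_mul_le_mul_left ?_ h0
      calc Real.sqrt A * Real.sqrt A = A := by rw [← pow_two, hs]
        _ ≤ _ := key
        _ = _ := by ring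
    calc A = Real.sqrt A ^ 2 := hs.symm
      _ ≤ (C * Real.sqrt a) ^ 2 := pow_le_pow_left₀ p1 h6 2
      _ = _ := by rw [mul_pow, hsa]


/-- coercivity via oscillation, Proposition 1 of the paper:
on a bounded open `X ⊆ ℝ^D` with `b` a `C¹` coefficient field, suppose a current `J`
satisfies `‖J - cb‖² ≤ C₁ 𝔞(J,J)` with `c = ⟨Juᵀ⟩`, and that test functions control
`⟨φ, c·∇b_j⟩` by `C₂ ‖φ‖ 𝔞(J,J)^{1/2}`.  If the oscillation constant
`𝔒 = min_{|θ|=1} max_j ⟨(θ·∇b_j)²⟩` is positive, then `|c|² 𝔒 ≤ C₂² 𝔞(J,J)`, and hence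
`‖J‖² ≤ (C'/𝔒) 𝔞(J,J)` with `C' = 2C₁𝔒 + 2 Mb C₂²` (`Mb` a bound on `∫_X |b|²`). -/
theorem stmt14 (D m : ℕ) (X : Set (Fin D → ℝ))
    (hXopen : IsOpen X) (hXbdd : Bornology.IsBounded X)
    (b : (Fin D → ℝ) → Fin m → ℝ) (hb : ∀ j, ContDiff ℝ 1 fun x => b x j)
    (J : (Fin D → ℝ) → Fin D → Fin m → ℝ) (c : Fin D → ℝ)
    (aJJ C₁ C₂ Mb 𝔒 : ℝ) (haJJ : 0 ≤ aJJ) (hC₂ : 0 ≤ C₂) (h𝔒 : 0 < 𝔒)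
    (hbint : IntegrableOn (fun x => ∑ kk, (b x kk) ^ 2) X volume)
    (hJint : IntegrableOn (fun x => ∑ l, ∑ kk, (J x l kk) ^ 2) X volume)
    (hdint : IntegrableOn (fun x => ∑ l, ∑ kk, (J x l kk - c l * b x kk) ^ 2) X volume)
    (hMb : (∫ x in X, ∑ kk, (b x kk) ^ 2) ≤ Mb)
    (hdecomp : (∫ x in X, ∑ l, ∑ kk, (J x l kk - c l * b x kk) ^ 2) ≤ C₁ * aJJ)
    (htest : ∀ φ : (Fin D → ℝ) → ℝ, ContDiff ℝ (⊤ : ℕ∞) φ → HasCompactSupport φ →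
      tsupport φ ⊆ X → ∀ j,
      |∫ x in X, φ x * ∑ l, c l * fderiv ℝ (fun y => b y j) x (Pi.single l 1)| ≤
        C₂ * (∫ x in X, (φ x) ^ 2) ^ (1 / 2 : ℝ) * aJJ ^ (1 / 2 : ℝ))
    (hosc : ∀ θ : Fin D → ℝ, (∑ l, (θ l) ^ 2) = 1 → ∃ j,
      𝔒 ≤ ∫ x in X, (∑ l, θ l * fderiv ℝ (fun y => b y j) x (Pi.single l 1)) ^ 2) :
    (∑ l, (c l) ^ 2) * 𝔒 ≤ C₂ ^ 2 * aJJ ∧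
    (∫ x in X, ∑ l, ∑ kk, (J x l kk) ^ 2) ≤
      ((2 * C₁ * 𝔒 + 2 * Mb * C₂ ^ 2) / 𝔒) * aJJ := by
  have hfirst : (∑ l, (c l) ^ 2) * 𝔒 ≤ C₂ ^ 2 * aJJ := by
    have hS : 0 ≤ ∑ l, (c l) ^ 2 := Finset.sum_nonneg fun _ _ => sq_nonneg _
    rcases hS.eq_or_lt with h0 | h0
    · rw [← h0, zero_mul]; positivity
    · set S := ∑ l, (c l) ^ 2 with hSdef
      have hss := Real.sq_sqrt hS
      have hsp := Real.sqrt_pos.2 h0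
      obtain ⟨j, hj⟩ := hosc (fun l => c l / Real.sqrt S) (by
        simp only [div_pow, hss]
        rw [← Finset.sum_div, ← hSdef, div_self h0.ne'])
      have hcont : Continuous fun x =>
          ∑ l, c l * fderiv ℝ (fun y => b y j) x (Pi.single l 1) := by
        refine continuous_finset_sum _ fun l _ => continuous_const.mul ?_
        exact ((hb j).continuous_fderiv (by norm_num)).clm_apply continuous_const
      have h1 := stmt14_aux hXopen hXbdd _ hcont aJJ C₂ haJJ hC₂
        (fun φ h1 h2 h3 => htest φ h1 h2 h3 j)
      refine le_trans ?_ h1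
      have h2 : ∀ x, (∑ l, c l / Real.sqrt S *
          fderiv ℝ (fun y => b y j) x (Pi.single l 1)) ^ 2 =
          S⁻¹ * (∑ l, c l * fderiv ℝ (fun y => b y j) x (Pi.single l 1)) ^ 2 := by
        intro x
        have : ∑ l, c l / Real.sqrt S * fderiv ℝ (fun y => b y j) x (Pi.single l 1) =
            (Real.sqrt S)⁻¹ * ∑ l, c l * fderiv ℝ (fun y => b y j) x (Pi.single l 1) := by
          rw [Finset.mul_sum]
          exact Finset.sum_congr rfl fun l _ => by ring
        rw [this, mul_pow, inv_pow, hss]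
      simp only [h2] at hj
      rw [integral_const_mul] at hj
      calc S * 𝔒 ≤ S * (S⁻¹ * _) := mul_le_mul_of_nonneg_left hj hS
        _ = _ := by rw [← mul_assoc, mul_inv_cancel₀ h0.ne', one_mul]
  refine ⟨hfirst, ?_⟩
  have hMb0 : 0 ≤ Mb := le_trans (integral_nonneg fun x =>
    Finset.sum_nonneg fun _ _ => sq_nonneg _) hMb
  have hS : 0 ≤ ∑ l, (c l) ^ 2 := Finset.sum_nonneg fun _ _ => sq_nonneg _
  have hI : (∫ x in X, ∑ l, ∑ kk, (J x l kk) ^ 2) ≤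
      ∫ x in X, (2 * (∑ l, ∑ kk, (J x l kk - c l * b x kk) ^ 2) +
        (2 * ∑ l, (c l) ^ 2) * ∑ kk, (b x kk) ^ 2) := by
    refine integral_mono hJint ((hdint.const_mul 2).add (hbint.const_mul _)) fun x => ?_
    have : (2 * ∑ l, (c l) ^ 2) * ∑ kk, (b x kk) ^ 2 =
        ∑ l, ∑ kk, 2 * (c l * b x kk) ^ 2 := by
      rw [mul_assoc, Finset.sum_mul_sum, Finset.mul_sum]
      refine Finset.sum_congr rfl fun l _ => ?_
      rw [Finset.mul_sum]
      exact Finset.sum_congr rfl fun k _ => by ring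
    simp only [this]
    rw [Finset.mul_sum, ← Finset.sum_add_distrib]
    refine Finset.sum_le_sum fun l _ => ?_
    rw [Finset.mul_sum, ← Finset.sum_add_distrib]
    refine Finset.sum_le_sum fun k _ => ?_
    nlinarith [sq_nonneg (J x l k - 2 * (c l * b x k))]
  rw [integral_add (hdint.const_mul 2) (hbint.const_mul _), integral_const_mul,
    integral_const_mul] at hI
  have h3 : (2 * ∑ l, (c l) ^ 2) * (∫ x in X, ∑ kk, (b x kk) ^ 2) ≤
      (2 * ∑ l, (c l) ^ 2) * Mb := mul_le_mul_of_nonneg_left hMb (by positivity)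
  have h4 : (∑ l, (c l) ^ 2) ≤ C₂ ^ 2 * aJJ / 𝔒 := (le_div_iff₀ h𝔒).2 hfirst
  have h5 := mul_le_mul_of_nonneg_right h4 hMb0
  have h6 : ((2 * C₁ * 𝔒 + 2 * Mb * C₂ ^ 2) / 𝔒) * aJJ =
      2 * (C₁ * aJJ) + 2 * (C₂ ^ 2 * aJJ / 𝔒 * Mb) := by
    field_simp
  rw [h6]
  linarith
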